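/- arXiv:2211.03218 — 8 statements merged into one kernel-verified Lean document; each statement's English description precedes it below -/
import Mathlib

section
/- For every j ∈ C and every i ∈ I∖C (so that λ_{h,i} ≠ λ_j), the identity (P_h u_j, u_{h,i}) = (λ_j / (λ_{h,i} − λ_j)) (u_j − P_h u_j, u_{h,i}) holds. -/
open scoped RealInnerProductSpace

/-- for every j ∈ C and i ∈ I∖C,
(P_h u_j, u_{h,i}) = (λ_j / (λ_{h,i} − λ_j)) (u_j − P_h u_j, u_{h,i}). -/
theorem stmt1
    {H : Type*} [NormedAddCommGroup H] [InnerProductSpace ℝ H]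
    {ι : Type*} [Fintype ι] [DecidableEq ι]
    (V : Submodule ℝ H)
    (a : H →ₗ[ℝ] H →ₗ[ℝ] ℝ)
    (hsym : ∀ x ∈ V, ∀ y ∈ V, a x y = a y x)
    (C : Finset ι) (hC : C.Nonempty) (hCc : Cᶜ.Nonempty)
    (uh : ι → H) (huh : Orthonormal ℝ uh)
    (hVh : Submodule.span ℝ (Set.range uh) ≤ V)
    (lamh : ι → ℝ) (hlamh_pos : ∀ i, 0 < lamh i)
    (heigh : ∀ i : ι, ∀ vh ∈ Submodule.span ℝ (Set.range uh),
      a (uh i) vh = lamh i * ⟪uh i, vh⟫)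
    (u : ι → H) (hu : Orthonormal ℝ (fun (j : C) => u (j : ι)))
    (huV : ∀ j ∈ C, u j ∈ V)
    (lam : ι → ℝ) (hlam_pos : ∀ j ∈ C, 0 < lam j)
    (heig : ∀ j ∈ C, ∀ v ∈ V, a (u j) v = lam j * ⟪u j, v⟫)
    (hsep : ∀ i ∈ Cᶜ, ∀ j ∈ C, lamh i ≠ lam j)
    (Ph : H →ₗ[ℝ] H)
    (hPh_mem : ∀ w : H, Ph w ∈ Submodule.span ℝ (Set.range uh))
    (hGal : ∀ w ∈ V, ∀ vh ∈ Submodule.span ℝ (Set.range uh), a (w - Ph w) vh = 0)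
    :
    ∀ j ∈ C, ∀ i ∈ Cᶜ,
      ⟪Ph (u j), uh i⟫ = (lam j / (lamh i - lam j)) * ⟪u j - Ph (u j), uh i⟫ := by
  intro j hj i hi
  have hmem : uh i ∈ Submodule.span ℝ (Set.range uh) := Submodule.subset_span ⟨i, rfl⟩
  have hgal := hGal (u j) (huV j hj) (uh i) hmem
  rw [map_sub, LinearMap.sub_apply, heig j hj _ (hVh hmem),
    hsym _ (hVh (hPh_mem _)) _ (hVh hmem), heigh i _ (hPh_mem _),
    real_inner_comm (Ph (u j)) (uh i)] at hgal
  have hne : lamh i - lam j ≠ 0 := sub_ne_zero.mpr (hsep i hi j hj)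
  rw [inner_sub_left]
  field_simp
  linarith
end

section
/- For every j ∈ C, the single-eigenfunction projection error bound ‖P_h u_j − Π_h^C (P_h u_j)‖ ≤ τ ‖u_j − P_h u_j‖ holds. -/
open scoped RealInnerProductSpace

theorem Orthonormal.norm_sq_eq_sum_of_mem_span
    {H : Type*} [NormedAddCommGroup H] [InnerProductSpace ℝ H] {ι : Type*} [Fintype ι]
    {e : ι → H} (he : Orthonormal ℝ e) {x : H} (hx : x ∈ Submodule.span ℝ (Set.range e)) :
    ‖x‖ ^ 2 = ∑ i, ⟪e i, x⟫ ^ 2 := by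
  obtain ⟨c, rfl⟩ := (Submodule.mem_span_range_iff_exists_fun ℝ).1 hx
  rw [← real_inner_self_eq_norm_sq, he.inner_sum]
  simp only [he.inner_right_fintype]
  simp [pow_two]

/-- Domination of coefficients bounds the norm of a vector in the span of an orthonormal family. -/
theorem Orthonormal.norm_le_mul_norm_of_abs_inner_le
    {H : Type*} [NormedAddCommGroup H] [InnerProductSpace ℝ H] {ι : Type*} [Fintype ι]
    {e : ι → H} (he : Orthonormal ℝ e) {x y : H} (hx : x ∈ Submodule.span ℝ (Set.range e))
    {K : ℝ} (hK : 0 ≤ K) (h : ∀ i, |⟪e i, x⟫| ≤ K * |⟪e i, y⟫|) :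
    ‖x‖ ≤ K * ‖y‖ := by
  refine (sq_le_sq₀ (norm_nonneg x) (by positivity)).1 ?_
  have bessel : ∑ i, ⟪e i, y⟫ ^ 2 ≤ ‖y‖ ^ 2 := by
    simpa using he.sum_inner_products_le y (s := Finset.univ)
  calc ‖x‖ ^ 2 = ∑ i, ⟪e i, x⟫ ^ 2 := he.norm_sq_eq_sum_of_mem_span hx
    _ ≤ ∑ i, K ^ 2 * ⟪e i, y⟫ ^ 2 := by
        refine Finset.sum_le_sum fun i _ => ?_
        rw [← sq_abs, ← sq_abs ⟪e i, y⟫, ← mul_pow]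
        exact pow_le_pow_left₀ (abs_nonneg _) (h i) 2
    _ = K ^ 2 * ∑ i, ⟪e i, y⟫ ^ 2 := by rw [Finset.mul_sum]
    _ ≤ (K * ‖y‖) ^ 2 := by
        rw [mul_pow]
        gcongr

/-- for every j ∈ C, ‖P_h u_j − Π_h^C (P_h u_j)‖ ≤ τ ‖u_j − P_h u_j‖,
where Π_h^C is the H-orthogonal projection onto E_h = span{u_{h,i} : i ∈ C} and
τ = max_{j∈C} max_{i∈I∖C} λ_j / |λ_{h,i} − λ_j|. -/
theorem stmt2
    {H : Type*} [NormedAddCommGroup H] [InnerProductSpace ℝ H]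
    {ι : Type*} [Fintype ι] [DecidableEq ι]
    (V : Submodule ℝ H)
    (a : H →ₗ[ℝ] H →ₗ[ℝ] ℝ)
    (hsym : ∀ x ∈ V, ∀ y ∈ V, a x y = a y x)
    (C : Finset ι) (hC : C.Nonempty) (hCc : Cᶜ.Nonempty)
    (uh : ι → H) (huh : Orthonormal ℝ uh)
    (hVh : Submodule.span ℝ (Set.range uh) ≤ V)
    (lamh : ι → ℝ) (hlamh_pos : ∀ i, 0 < lamh i)
    (heigh : ∀ i : ι, ∀ vh ∈ Submodule.span ℝ (Set.range uh),
      a (uh i) vh = lamh i * ⟪uh i, vh⟫)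
    (u : ι → H) (hu : Orthonormal ℝ (fun (j : C) => u (j : ι)))
    (huV : ∀ j ∈ C, u j ∈ V)
    (lam : ι → ℝ) (hlam_pos : ∀ j ∈ C, 0 < lam j)
    (heig : ∀ j ∈ C, ∀ v ∈ V, a (u j) v = lam j * ⟪u j, v⟫)
    (hsep : ∀ i ∈ Cᶜ, ∀ j ∈ C, lamh i ≠ lam j)
    (Ph : H →ₗ[ℝ] H)
    (hPh_mem : ∀ w : H, Ph w ∈ Submodule.span ℝ (Set.range uh))
    (hGal : ∀ w ∈ V, ∀ vh ∈ Submodule.span ℝ (Set.range uh), a (w - Ph w) vh = 0)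
    (Pic : H →ₗ[ℝ] H)
    (hPic_mem : ∀ φ : H, Pic φ ∈ Submodule.span ℝ (uh '' (C : Set ι)))
    (hPic_orth : ∀ φ : H, ∀ w ∈ Submodule.span ℝ (uh '' (C : Set ι)), ⟪φ - Pic φ, w⟫ = 0)
    (τ τh : ℝ)
    (hτ : τ = C.sup' hC fun j => Cᶜ.sup' hCc fun i => lam j / |lamh i - lam j|)
    (hτh : τh = C.sup' hC fun j => Cᶜ.sup' hCc fun i => lamh i / |lamh i - lam j|)
    :
    ∀ j ∈ C, ‖Ph (u j) - Pic (Ph (u j))‖ ≤ τ * ‖u j - Ph (u j)‖ := by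
  intro j hj
  have le_τ : ∀ i ∈ Cᶜ, lam j / |lamh i - lam j| ≤ τ := by
    intro i hi
    rw [hτ]
    exact (Finset.le_sup' (fun i => lam j / |lamh i - lam j|) hi).trans
      (Finset.le_sup' (fun j => Cᶜ.sup' hCc fun i => lam j / |lamh i - lam j|) hj)
  have τ_nonneg : 0 ≤ τ := by
    obtain ⟨i, hi⟩ := hCc
    exact (div_nonneg (hlam_pos j hj).le (abs_nonneg _)).trans (le_τ i hi)
  refine huh.norm_le_mul_norm_of_abs_inner_le (Submodule.sub_mem _ (hPh_mem _)
    (Submodule.span_mono (Set.image_subset_range _ _) (hPic_mem _))) τ_nonneg fun i => ?_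
  by_cases hi : i ∈ C
  · rw [real_inner_comm, hPic_orth _ _ (Submodule.subset_span (Set.mem_image_of_mem uh hi)),
      abs_zero]
    positivity
  have hi' : i ∈ Cᶜ := Finset.mem_compl.2 hi
  have uh_mem : uh i ∈ Submodule.span ℝ (Set.range uh) := Submodule.subset_span ⟨i, rfl⟩
  have inner_Pic : ⟪uh i, Pic (Ph (u j))⟫ = 0 := by
    refine (Submodule.mem_orthogonal_singleton_iff_inner_right).1
      (Submodule.span_le.2 ?_ (hPic_mem (Ph (u j))))
    rintro _ ⟨k, hk, rfl⟩
    refine Submodule.mem_orthogonal_singleton_iff_inner_right.2 (huh.2 ?_)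
    rintro rfl
    exact hi hk
  have galerkin : lamh i * ⟪uh i, Ph (u j)⟫ = lam j * ⟪uh i, u j⟫ := by
    have h := hGal _ (huV j hj) _ uh_mem
    rw [map_sub, LinearMap.sub_apply, heig j hj _ (hVh uh_mem),
      hsym _ (hVh (hPh_mem _)) _ (hVh uh_mem), heigh i _ (hPh_mem _),
      real_inner_comm] at h
    linarith
  have gap_pos : 0 < |lamh i - lam j| := abs_pos.2 (sub_ne_zero.2 (hsep i hi' j hj))
  have gap_identity : |lamh i - lam j| * |⟪uh i, Ph (u j)⟫|
      = lam j * |⟪uh i, u j - Ph (u j)⟫| := by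
    rw [← abs_of_pos (hlam_pos j hj), ← abs_mul, ← abs_mul, abs_of_pos (hlam_pos j hj),
      inner_sub_right]
    congr 1
    linarith
  rw [inner_sub_right, inner_Pic, sub_zero]
  calc |⟪uh i, Ph (u j)⟫|
      = lam j / |lamh i - lam j| * |⟪uh i, u j - Ph (u j)⟫| := by
        rw [div_mul_eq_mul_div, ← gap_identity, mul_div_cancel_left₀ _ gap_pos.ne']
    _ ≤ τ * |⟪uh i, u j - Ph (u j)⟫| := by
        gcongr
        exact le_τ i hi'
end

section
/- For every u ∈ E^B, the bound ‖P_h u − Π_h^C (P_h u)‖ ≤ τ |C|^{1/2} M holds, where |C| is the cardinality of C; in other words, the optimal constant β in the inequality ‖P_h u − Π_h^C (P_h u)‖ ≤ β M (for all u ∈ E^B) satisfies β ≤ τ |C|^{1/2}. -/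
open scoped RealInnerProductSpace

theorem Orthonormal.sum_inner_smul_of_mem_span {H ι : Type*} [NormedAddCommGroup H]
    [InnerProductSpace ℝ H] [Fintype ι] {e : ι → H} (he : Orthonormal ℝ e) {x : H}
    (hx : x ∈ Submodule.span ℝ (Set.range e)) : ∑ i, ⟪e i, x⟫ • e i = x := by
  obtain ⟨c, rfl⟩ := (Submodule.mem_span_range_iff_exists_fun ℝ).1 hx
  exact Finset.sum_congr rfl fun i _ => by rw [he.inner_right_fintype]

theorem Orthonormal.norm_sq_eq_sum_inner_sq_of_mem_span {H ι : Type*} [NormedAddCommGroup H]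
    [InnerProductSpace ℝ H] [Fintype ι] {e : ι → H} (he : Orthonormal ℝ e) {x : H}
    (hx : x ∈ Submodule.span ℝ (Set.range e)) : ‖x‖ ^ 2 = ∑ i, ⟪e i, x⟫ ^ 2 := by
  rw [← real_inner_self_eq_norm_sq]
  nth_rewrite 1 [← he.sum_inner_smul_of_mem_span hx]
  simp only [sum_inner, real_inner_smul_left, sq]

/-- A linear map is bounded on the unit vectors of the span of a finite orthonormal family. -/
theorem Orthonormal.norm_map_le_sum_of_mem_span {H F ι : Type*} [NormedAddCommGroup H]
    [InnerProductSpace ℝ H] [NormedAddCommGroup F] [NormedSpace ℝ F] [Fintype ι] {e : ι → H}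
    (he : Orthonormal ℝ e) (T : H →ₗ[ℝ] F) {x : H}
    (hx : x ∈ Submodule.span ℝ (Set.range e)) (hx1 : ‖x‖ = 1) :
    ‖T x‖ ≤ ∑ i, ‖T (e i)‖ := by
  nth_rewrite 1 [← he.sum_inner_smul_of_mem_span hx]
  rw [map_sum]
  refine (norm_sum_le _ _).trans (Finset.sum_le_sum fun i _ => ?_)
  rw [map_smul, norm_smul]
  refine mul_le_of_le_one_left (norm_nonneg _) ?_
  simpa [he.1 i, hx1] using norm_inner_le_norm (𝕜 := ℝ) (e i) x

/-- for every u ∈ E^B, ‖P_h u − Π_h^C (P_h u)‖ ≤ τ |C|^{1/2} M,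
where M = sup_{v ∈ E^B} ‖v − P_h v‖; i.e. the optimal constant β in
‖P_h u − Π_h^C (P_h u)‖ ≤ β M satisfies β ≤ τ |C|^{1/2}. -/
theorem stmt3
    {H : Type*} [NormedAddCommGroup H] [InnerProductSpace ℝ H]
    {ι : Type*} [Fintype ι] [DecidableEq ι]
    (V : Submodule ℝ H)
    (a : H →ₗ[ℝ] H →ₗ[ℝ] ℝ)
    (hsym : ∀ x ∈ V, ∀ y ∈ V, a x y = a y x)
    (C : Finset ι) (hC : C.Nonempty) (hCc : Cᶜ.Nonempty)
    (uh : ι → H) (huh : Orthonormal ℝ uh)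
    (hVh : Submodule.span ℝ (Set.range uh) ≤ V)
    (lamh : ι → ℝ) (hlamh_pos : ∀ i, 0 < lamh i)
    (heigh : ∀ i : ι, ∀ vh ∈ Submodule.span ℝ (Set.range uh),
      a (uh i) vh = lamh i * ⟪uh i, vh⟫)
    (u : ι → H) (hu : Orthonormal ℝ (fun (j : C) => u (j : ι)))
    (huV : ∀ j ∈ C, u j ∈ V)
    (lam : ι → ℝ) (hlam_pos : ∀ j ∈ C, 0 < lam j)
    (heig : ∀ j ∈ C, ∀ v ∈ V, a (u j) v = lam j * ⟪u j, v⟫)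
    (hsep : ∀ i ∈ Cᶜ, ∀ j ∈ C, lamh i ≠ lam j)
    (Ph : H →ₗ[ℝ] H)
    (hPh_mem : ∀ w : H, Ph w ∈ Submodule.span ℝ (Set.range uh))
    (hGal : ∀ w ∈ V, ∀ vh ∈ Submodule.span ℝ (Set.range uh), a (w - Ph w) vh = 0)
    (Pic : H →ₗ[ℝ] H)
    (hPic_mem : ∀ φ : H, Pic φ ∈ Submodule.span ℝ (uh '' (C : Set ι)))
    (hPic_orth : ∀ φ : H, ∀ w ∈ Submodule.span ℝ (uh '' (C : Set ι)), ⟪φ - Pic φ, w⟫ = 0)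
    (τ τh : ℝ)
    (hτ : τ = C.sup' hC fun j => Cᶜ.sup' hCc fun i => lam j / |lamh i - lam j|)
    (hτh : τh = C.sup' hC fun j => Cᶜ.sup' hCc fun i => lamh i / |lamh i - lam j|)
    (M : ℝ)
    (hM : M = sSup ((fun v => ‖v - Ph v‖) ''
      {v : H | v ∈ Submodule.span ℝ (u '' (C : Set ι)) ∧ ‖v‖ = 1}))
    :
    ∀ w ∈ Submodule.span ℝ (u '' (C : Set ι)), ‖w‖ = 1 →
      ‖Ph w - Pic (Ph w)‖ ≤ τ * Real.sqrt C.card * M := by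
  intro w hw hw1
  have hwr : w ∈ Submodule.span ℝ (Set.range fun j : C => u (j : ι)) := by
    rw [Set.image_eq_range] at hw
    exact hw
  have hdefect : ∀ j ∈ C, ‖u j - Ph (u j)‖ ≤ M := by
    intro j hj
    rw [hM]
    refine le_csSup ⟨∑ j : C, ‖((LinearMap.id : H →ₗ[ℝ] H) - Ph) (u j)‖, ?_⟩
      ⟨u j, ⟨Submodule.subset_span ⟨j, hj, rfl⟩, hu.1 ⟨j, hj⟩⟩, rfl⟩
    rintro _ ⟨v, ⟨hv, hv1⟩, rfl⟩
    rw [Set.image_eq_range] at hv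
    exact hu.norm_map_le_sum_of_mem_span (LinearMap.id - Ph) hv hv1
  have hτle : ∀ j ∈ C, ∀ i ∈ Cᶜ, lam j / |lamh i - lam j| ≤ τ := by
    intro j hj i hi
    rw [hτ]
    exact (Finset.le_sup' (fun i => lam j / |lamh i - lam j|) hi).trans
      (Finset.le_sup' (fun j => Cᶜ.sup' hCc fun i => lam j / |lamh i - lam j|) hj)
  obtain ⟨j₀, hj₀⟩ := hC
  obtain ⟨i₀, hi₀⟩ := hCc
  have hτ0 : 0 ≤ τ :=
    (div_nonneg (hlam_pos j₀ hj₀).le (abs_nonneg _)).trans (hτle j₀ hj₀ i₀ hi₀)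
  have hM0 : 0 ≤ M := (norm_nonneg _).trans (hdefect j₀ hj₀)
  have huh_mem : ∀ i, uh i ∈ Submodule.span ℝ (Set.range uh) := fun i =>
    Submodule.subset_span ⟨i, rfl⟩
  have hcoeff : ∀ j ∈ C, ∀ i ∈ Cᶜ,
      ⟪uh i, Ph (u j)⟫ ^ 2 ≤ τ ^ 2 * ⟪uh i, u j - Ph (u j)⟫ ^ 2 := by
    intro j hj i hi
    have hgal := hGal (u j) (huV j hj) (uh i) (huh_mem i)
    rw [map_sub, LinearMap.sub_apply, heig j hj _ (hVh (huh_mem i)),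
      hsym _ (hVh (hPh_mem _)) _ (hVh (huh_mem i)), heigh i _ (hPh_mem _),
      real_inner_comm] at hgal
    have hne : lamh i - lam j ≠ 0 := sub_ne_zero.2 (hsep i hi j hj)
    have heq : ⟪uh i, Ph (u j)⟫ =
        lam j / (lamh i - lam j) * ⟪uh i, u j - Ph (u j)⟫ := by
      rw [inner_sub_right]
      field_simp
      linarith
    rw [heq, mul_pow]
    refine mul_le_mul_of_nonneg_right ?_ (sq_nonneg _)
    rw [← sq_abs, abs_div, abs_of_pos (hlam_pos j hj)]
    exact pow_le_pow_left₀ (div_nonneg (hlam_pos j hj).le (abs_nonneg _)) (hτle j hj i hi) 2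
  have hPhw : ∀ i, ⟪uh i, Ph w⟫ ^ 2 ≤ ∑ j ∈ C, ⟪uh i, Ph (u j)⟫ ^ 2 := by
    intro i
    have hsq := hu.norm_sq_eq_sum_inner_sq_of_mem_span hwr
    nth_rewrite 1 [← hu.sum_inner_smul_of_mem_span hwr]
    simp only [map_sum, map_smul, inner_sum, real_inner_smul_right]
    refine (Finset.sum_mul_sq_le_sq_mul_sq _ _ _).trans ?_
    rw [← hsq, hw1, one_pow, one_mul, Finset.sum_coe_sort C fun j => ⟪uh i, Ph (u j)⟫ ^ 2]
  have hPic_range : Pic (Ph w) ∈ Submodule.span ℝ (Set.range uh) :=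
    Submodule.span_mono (Set.image_subset_range _ _) (hPic_mem _)
  have hin : ∀ i ∈ C, ⟪uh i, Ph w - Pic (Ph w)⟫ = 0 := by
    intro i hi
    rw [real_inner_comm]
    exact hPic_orth _ _ (Submodule.subset_span ⟨i, hi, rfl⟩)
  have hout : ∀ i ∈ Cᶜ, ⟪uh i, Ph w - Pic (Ph w)⟫ = ⟪uh i, Ph w⟫ := by
    intro i hi
    have horth : Submodule.span ℝ (uh '' (C : Set ι)) ≤ (Submodule.span ℝ {uh i})ᗮ := by
      rw [Submodule.span_le]
      rintro _ ⟨k, hk, rfl⟩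
      refine Submodule.mem_orthogonal_singleton_iff_inner_right.2 (huh.2 ?_)
      rintro rfl
      exact Finset.mem_compl.1 hi hk
    rw [inner_sub_right, Submodule.mem_orthogonal_singleton_iff_inner_right.1
      (horth (hPic_mem (Ph w))), sub_zero]
  refine abs_le_of_sq_le_sq' ?_ (by positivity) |>.2
  calc ‖Ph w - Pic (Ph w)‖ ^ 2
      = ∑ i ∈ Cᶜ, ⟪uh i, Ph w⟫ ^ 2 := by
        rw [huh.norm_sq_eq_sum_inner_sq_of_mem_span
            (Submodule.sub_mem _ (hPh_mem w) hPic_range), ← Finset.sum_add_sum_compl C,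
          Finset.sum_eq_zero fun i hi => by rw [hin i hi, zero_pow two_ne_zero], zero_add]
        exact Finset.sum_congr rfl fun i hi => by rw [hout i hi]
    _ ≤ ∑ i ∈ Cᶜ, ∑ j ∈ C, τ ^ 2 * ⟪uh i, u j - Ph (u j)⟫ ^ 2 :=
        Finset.sum_le_sum fun i hi =>
          (hPhw i).trans (Finset.sum_le_sum fun j hj => hcoeff j hj i hi)
    _ = ∑ j ∈ C, τ ^ 2 * ∑ i ∈ Cᶜ, ⟪uh i, u j - Ph (u j)⟫ ^ 2 := by
        rw [Finset.sum_comm]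
        simp only [Finset.mul_sum]
    _ ≤ ∑ _j ∈ C, τ ^ 2 * M ^ 2 := by
        refine Finset.sum_le_sum fun j hj => mul_le_mul_of_nonneg_left ?_ (sq_nonneg _)
        have hbessel := huh.sum_inner_products_le (s := Cᶜ) (u j - Ph (u j))
        simp only [Real.norm_eq_abs, sq_abs] at hbessel
        exact hbessel.trans (pow_le_pow_left₀ (norm_nonneg _) (hdefect j hj) 2)
    _ = (τ * Real.sqrt C.card * M) ^ 2 := by
        rw [Finset.sum_const, nsmul_eq_mul, mul_pow, mul_pow, Real.sq_sqrt (Nat.cast_nonneg _)]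
        ring
end

section
/- The directed L² distance of the exact eigenfunction space E from the approximate space E_h satisfies δ_b(E, E_h) := sup_{u ∈ E^B} inf_{v ∈ E_h} ‖u − v‖ ≤ (1 + β) M; moreover, for each u ∈ E^B the infimum is attained at the projection, i.e. inf_{v ∈ E_h} ‖u − v‖ = ‖u − Π_h^C u‖. -/
open scoped RealInnerProductSpace

/-- The distances from a vector to a subspace form a set bounded below by `0`. -/
theorem bddBelow_norm_sub_image {H : Type*} [NormedAddCommGroup H] (w : H) (s : Set H) :
    BddBelow ((fun v => ‖w - v‖) '' s) := by
  refine ⟨0, ?_⟩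
  rintro _ ⟨v, -, rfl⟩
  exact norm_nonneg _

/-- If `p ∈ K` and `w - p` is orthogonal to `K`, then `p` minimizes the distance from `w`. -/
theorem sInf_norm_sub_eq_of_inner_eq_zero {H : Type*} [NormedAddCommGroup H]
    [InnerProductSpace ℝ H] {K : Submodule ℝ H} {w p : H} (hp : p ∈ K)
    (horth : ∀ v ∈ K, ⟪w - p, v⟫ = 0) :
    sInf ((fun v => ‖w - v‖) '' (K : Set H)) = ‖w - p‖ := by
  refine IsLeast.csInf_eq ⟨⟨p, hp, rfl⟩, ?_⟩
  rintro _ ⟨v, hv, rfl⟩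
  have h := norm_add_sq_eq_norm_sq_add_norm_sq_of_inner_eq_zero (w - p) (p - v)
    (horth _ (K.sub_mem hp hv))
  rw [sub_add_sub_cancel] at h
  exact abs_le_of_sq_le_sq' (by nlinarith [mul_self_nonneg ‖p - v‖]) (norm_nonneg _) |>.2

/-- A linear map is bounded on the unit sphere of a finite-dimensional subspace. -/
theorem bddAbove_norm_image_unit_sphere {H F : Type*} [NormedAddCommGroup H] [NormedSpace ℝ H]
    [NormedAddCommGroup F] [NormedSpace ℝ F] (E : Submodule ℝ H) [FiniteDimensional ℝ E]
    (T : H →ₗ[ℝ] F) :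
    BddAbove ((fun v => ‖T v‖) '' {v : H | v ∈ E ∧ ‖v‖ = 1}) := by
  let S : E →L[ℝ] F := LinearMap.toContinuousLinearMap (T ∘ₗ E.subtype)
  refine ⟨‖S‖, ?_⟩
  rintro _ ⟨v, ⟨hv, hv1⟩, rfl⟩
  exact S.unit_le_opNorm ⟨v, hv⟩ hv1.le

/-- δ_b(E, E_h) := sup_{u ∈ E^B} inf_{v ∈ E_h} ‖u − v‖ ≤ (1 + β) M,
and for each u ∈ E^B the infimum over E_h is attained at the orthogonal projection:
inf_{v ∈ E_h} ‖u − v‖ = ‖u − Π_h^C u‖. -/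
theorem stmt5
    {H : Type*} [NormedAddCommGroup H] [InnerProductSpace ℝ H]
    {ι : Type*} [Fintype ι] [DecidableEq ι]
    (V : Submodule ℝ H)
    (a : H →ₗ[ℝ] H →ₗ[ℝ] ℝ)
    (hsym : ∀ x ∈ V, ∀ y ∈ V, a x y = a y x)
    (C : Finset ι) (hC : C.Nonempty) (hCc : Cᶜ.Nonempty)
    (uh : ι → H) (huh : Orthonormal ℝ uh)
    (hVh : Submodule.span ℝ (Set.range uh) ≤ V)
    (lamh : ι → ℝ) (hlamh_pos : ∀ i, 0 < lamh i)
    (heigh : ∀ i : ι, ∀ vh ∈ Submodule.span ℝ (Set.range uh),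
      a (uh i) vh = lamh i * ⟪uh i, vh⟫)
    (u : ι → H) (hu : Orthonormal ℝ (fun (j : C) => u (j : ι)))
    (huV : ∀ j ∈ C, u j ∈ V)
    (lam : ι → ℝ) (hlam_pos : ∀ j ∈ C, 0 < lam j)
    (heig : ∀ j ∈ C, ∀ v ∈ V, a (u j) v = lam j * ⟪u j, v⟫)
    (hsep : ∀ i ∈ Cᶜ, ∀ j ∈ C, lamh i ≠ lam j)
    (Ph : H →ₗ[ℝ] H)
    (hPh_mem : ∀ w : H, Ph w ∈ Submodule.span ℝ (Set.range uh))
    (hGal : ∀ w ∈ V, ∀ vh ∈ Submodule.span ℝ (Set.range uh), a (w - Ph w) vh = 0)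
    (Pic : H →ₗ[ℝ] H)
    (hPic_mem : ∀ φ : H, Pic φ ∈ Submodule.span ℝ (uh '' (C : Set ι)))
    (hPic_orth : ∀ φ : H, ∀ w ∈ Submodule.span ℝ (uh '' (C : Set ι)), ⟪φ - Pic φ, w⟫ = 0)
    (M : ℝ)
    (hM : M = sSup ((fun v => ‖v - Ph v‖) ''
      {v : H | v ∈ Submodule.span ℝ (u '' (C : Set ι)) ∧ ‖v‖ = 1}))
    (β : ℝ) (hβ0 : 0 ≤ β)
    (hβ : ∀ w ∈ Submodule.span ℝ (u '' (C : Set ι)), ‖w‖ = 1 →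
      ‖Ph w - Pic (Ph w)‖ ≤ β * M)
    :
    sSup ((fun w => sInf ((fun v => ‖w - v‖) ''
          (Submodule.span ℝ (uh '' (C : Set ι)) : Set H))) ''
        {w : H | w ∈ Submodule.span ℝ (u '' (C : Set ι)) ∧ ‖w‖ = 1})
      ≤ (1 + β) * M ∧
    ∀ w ∈ Submodule.span ℝ (u '' (C : Set ι)), ‖w‖ = 1 →
      sInf ((fun v => ‖w - v‖) '' (Submodule.span ℝ (uh '' (C : Set ι)) : Set H))
        = ‖w - Pic w‖ := by
  have hfin : FiniteDimensional ℝ (Submodule.span ℝ (u '' (C : Set ι))) :=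
    FiniteDimensional.span_of_finite ℝ (C.finite_toSet.image u)
  have hM_le : ∀ w ∈ Submodule.span ℝ (u '' (C : Set ι)), ‖w‖ = 1 → ‖w - Ph w‖ ≤ M := by
    intro w hw hw1
    rw [hM]
    exact le_csSup (bddAbove_norm_image_unit_sphere _ (LinearMap.id - Ph)) ⟨w, ⟨hw, hw1⟩, rfl⟩
  refine ⟨?_, fun w _ _ => sInf_norm_sub_eq_of_inner_eq_zero (hPic_mem w) (hPic_orth w)⟩
  obtain ⟨j, hj⟩ := hC
  have hne : {w : H | w ∈ Submodule.span ℝ (u '' (C : Set ι)) ∧ ‖w‖ = 1}.Nonempty :=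
    ⟨u j, Submodule.subset_span ⟨j, hj, rfl⟩, hu.1 ⟨j, hj⟩⟩
  refine csSup_le (hne.image _) ?_
  rintro _ ⟨w, ⟨hw, hw1⟩, rfl⟩
  calc sInf ((fun v => ‖w - v‖) '' (Submodule.span ℝ (uh '' (C : Set ι)) : Set H))
      ≤ ‖w - Pic (Ph w)‖ := csInf_le (bddBelow_norm_sub_image w _) ⟨_, hPic_mem _, rfl⟩
    _ ≤ ‖w - Ph w‖ + ‖Ph w - Pic (Ph w)‖ := norm_sub_le_norm_sub_add_norm_sub _ _ _
    _ ≤ (1 + β) * M := by linarith [hM_le w hw hw1, hβ w hw hw1]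
end

section
/- The directed L² distance of the exact eigenfunction space E from the approximate space E_h satisfies the projection error-based guaranteed bound δ_b(E, E_h) := sup_{u ∈ E^B} inf_{v ∈ E_h} ‖u − v‖ ≤ (1 + β) λ_N C_h². -/
open scoped RealInnerProductSpace

/-- A diagonal map in an orthonormal family, with entries in `[0, L]`, increases norms by a factor
of at most `L`. -/
theorem Orthonormal.norm_sum_mul_smul_le {H κ : Type*} [NormedAddCommGroup H]
    [InnerProductSpace ℝ H] [Fintype κ] {e : κ → H} (he : Orthonormal ℝ e) {l : κ → ℝ} {L : ℝ}
    (hL : 0 ≤ L) (hl : ∀ j, 0 ≤ l j) (hlL : ∀ j, l j ≤ L) (c : κ → ℝ) :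
    ‖∑ j, (l j * c j) • e j‖ ≤ L * ‖∑ j, c j • e j‖ := by
  have norm_sq (d : κ → ℝ) : ‖∑ j, d j • e j‖ ^ 2 = ∑ j, d j ^ 2 := by
    rw [← real_inner_self_eq_norm_sq, he.inner_sum]
    exact Finset.sum_congr rfl fun j _ => by simp [sq]
  refine (sq_le_sq₀ (norm_nonneg _) (by positivity)).1 ?_
  rw [mul_pow, norm_sq, norm_sq, Finset.mul_sum]
  refine Finset.sum_le_sum fun j _ => ?_
  rw [mul_pow]
  exact mul_le_mul_of_nonneg_right (pow_le_pow_left₀ (hl j) (hlL j) 2) (sq_nonneg _)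

/-- δ_b(E, E_h) := sup_{u ∈ E^B} inf_{v ∈ E_h} ‖u − v‖ ≤ (1 + β) λ_N C_h². -/
theorem stmt6
    {H : Type*} [NormedAddCommGroup H] [InnerProductSpace ℝ H]
    {ι : Type*} [Fintype ι] [DecidableEq ι]
    (V : Submodule ℝ H)
    (a : H →ₗ[ℝ] H →ₗ[ℝ] ℝ)
    (hsym : ∀ x ∈ V, ∀ y ∈ V, a x y = a y x)
    (C : Finset ι) (hC : C.Nonempty) (hCc : Cᶜ.Nonempty)
    (uh : ι → H) (huh : Orthonormal ℝ uh)
    (hVh : Submodule.span ℝ (Set.range uh) ≤ V)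
    (lamh : ι → ℝ) (hlamh_pos : ∀ i, 0 < lamh i)
    (heigh : ∀ i : ι, ∀ vh ∈ Submodule.span ℝ (Set.range uh),
      a (uh i) vh = lamh i * ⟪uh i, vh⟫)
    (u : ι → H) (hu : Orthonormal ℝ (fun (j : C) => u (j : ι)))
    (huV : ∀ j ∈ C, u j ∈ V)
    (lam : ι → ℝ) (hlam_pos : ∀ j ∈ C, 0 < lam j)
    (heig : ∀ j ∈ C, ∀ v ∈ V, a (u j) v = lam j * ⟪u j, v⟫)
    (hsep : ∀ i ∈ Cᶜ, ∀ j ∈ C, lamh i ≠ lam j)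
    (Ph : H →ₗ[ℝ] H)
    (hPh_mem : ∀ w : H, Ph w ∈ Submodule.span ℝ (Set.range uh))
    (hGal : ∀ w ∈ V, ∀ vh ∈ Submodule.span ℝ (Set.range uh), a (w - Ph w) vh = 0)
    (Pic : H →ₗ[ℝ] H)
    (hPic_mem : ∀ φ : H, Pic φ ∈ Submodule.span ℝ (uh '' (C : Set ι)))
    (hPic_orth : ∀ φ : H, ∀ w ∈ Submodule.span ℝ (uh '' (C : Set ι)), ⟪φ - Pic φ, w⟫ = 0)
    (M : ℝ)
    (hM : M = sSup ((fun v => ‖v - Ph v‖) ''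
      {v : H | v ∈ Submodule.span ℝ (u '' (C : Set ι)) ∧ ‖v‖ = 1}))
    (lamn lamN ξ : ℝ)
    (hlamn : lamn = C.inf' hC lam) (hlamN : lamN = C.sup' hC lam)
    (hξ : ξ = (lamN - lamn) / lamn)
    (Ch : ℝ) (hCh0 : 0 ≤ Ch)
    (hCh : ∀ w ∈ V, ∀ f : H, (∀ v ∈ V, a w v = ⟪f, v⟫) → ‖w - Ph w‖ ≤ Ch ^ 2 * ‖f‖)
    (β : ℝ) (hβ0 : 0 ≤ β)
    (hβ : ∀ w ∈ Submodule.span ℝ (u '' (C : Set ι)), ‖w‖ = 1 →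
      ‖Ph w - Pic (Ph w)‖ ≤ β * M)
    :
    sSup ((fun w => sInf ((fun v => ‖w - v‖) ''
          (Submodule.span ℝ (uh '' (C : Set ι)) : Set H))) ''
        {w : H | w ∈ Submodule.span ℝ (u '' (C : Set ι)) ∧ ‖w‖ = 1})
      ≤ (1 + β) * lamN * Ch ^ 2 := by
  have hlamN0 : 0 ≤ lamN := by
    obtain ⟨j, hj⟩ := hC
    exact hlamN ▸ (hlam_pos j hj).le.trans (Finset.le_sup' lam hj)
  have proj_error_le : ∀ w ∈ Submodule.span ℝ (u '' (C : Set ι)), ‖w‖ = 1 →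
      ‖w - Ph w‖ ≤ Ch ^ 2 * lamN := by
    intro w hw hw1
    obtain ⟨c, rfl⟩ : ∃ c : C → ℝ, ∑ j : C, c j • u j = w := by
      rw [Set.image_eq_range] at hw
      exact (Submodule.mem_span_range_iff_exists_fun ℝ).1 hw
    have hf := hu.norm_sum_mul_smul_le (l := fun j : C => lam j) hlamN0
      (fun j => (hlam_pos j j.2).le) (fun j => hlamN ▸ Finset.le_sup' lam j.2) c
    rw [hw1, mul_one] at hf
    refine (hCh _ (V.sum_mem fun (j : C) _ => V.smul_mem _ (huV j j.2))
      (∑ j : C, (lam j * c j) • u j) fun v hv => ?_).trans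
      (mul_le_mul_of_nonneg_left hf (sq_nonneg _))
    simp only [map_sum, map_smul, LinearMap.sum_apply, LinearMap.smul_apply, sum_inner,
      real_inner_smul_left, smul_eq_mul]
    refine Finset.sum_congr rfl fun j _ => ?_
    rw [heig j j.2 v hv]
    ring
  have hM_le : M ≤ Ch ^ 2 * lamN := by
    rw [hM]
    refine Real.sSup_le ?_ (by positivity)
    rintro _ ⟨w, ⟨hw, hw1⟩, rfl⟩
    exact proj_error_le w hw hw1
  refine Real.sSup_le ?_ (by positivity)
  rintro _ ⟨w, ⟨hw, hw1⟩, rfl⟩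
  calc sInf ((fun v => ‖w - v‖) '' (Submodule.span ℝ (uh '' (C : Set ι)) : Set H))
      ≤ ‖w - Pic (Ph w)‖ :=
        csInf_le ⟨0, by rintro _ ⟨v, _, rfl⟩; exact norm_nonneg _⟩ ⟨_, hPic_mem _, rfl⟩
    _ ≤ ‖w - Ph w‖ + ‖Ph w - Pic (Ph w)‖ := norm_sub_le_norm_sub_add_norm_sub _ _ _
    _ ≤ Ch ^ 2 * lamN + β * (Ch ^ 2 * lamN) :=
        add_le_add (proj_error_le w hw hw1)
          ((hβ w hw hw1).trans (mul_le_mul_of_nonneg_left hM_le hβ0))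
    _ = (1 + β) * lamN * Ch ^ 2 := by ring
end

section
/- For every u = Σ_{j∈C} c_j u_j ∈ E^B, the distance to its rescaled image under κ satisfies ‖u − κu‖² = Σ_{j∈C} c_j² (1 − λ_j/λ̄)² ≤ ξ², and hence ‖u − κu‖ ≤ ξ. -/
open scoped RealInnerProductSpace

/-- Pythagoras' theorem for a finite linear combination of a family orthonormal on `C`. -/
lemma norm_sq_sum_smul_of_orthonormal {H : Type*} [NormedAddCommGroup H] [InnerProductSpace ℝ H]
    {ι : Type*} {C : Finset ι} {u : ι → H} (hu : Orthonormal ℝ (fun (j : C) => u (j : ι)))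
    (a : ι → ℝ) : ‖∑ j ∈ C, a j • u j‖ ^ 2 = ∑ j ∈ C, a j ^ 2 := by
  have h := hu.inner_sum (fun j : C => a j) (fun j : C => a j) Finset.univ
  rw [Finset.sum_coe_sort C (fun j => a j • u j), real_inner_self_eq_norm_sq] at h
  rw [h, ← Finset.sum_coe_sort C (fun j => a j ^ 2)]
  simp [sq]

/-- for every u = Σ_{j∈C} c_j u_j ∈ E^B, with λ̄ = (Σ c_j² λ_j²)^{1/2} and
κu = λ̄⁻¹ Σ c_j λ_j u_j, one has ‖u − κu‖² = Σ_{j∈C} c_j² (1 − λ_j/λ̄)² ≤ ξ², hence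
‖u − κu‖ ≤ ξ, where ξ = (λ_N − λ_n)/λ_n. -/
theorem stmt8
    {H : Type*} [NormedAddCommGroup H] [InnerProductSpace ℝ H]
    {ι : Type*}
    (C : Finset ι) (hC : C.Nonempty)
    (u : ι → H) (hu : Orthonormal ℝ (fun (j : C) => u (j : ι)))
    (lam : ι → ℝ) (hlam_pos : ∀ j ∈ C, 0 < lam j)
    (lamn lamN ξ : ℝ)
    (hlamn : lamn = C.inf' hC lam) (hlamN : lamN = C.sup' hC lam)
    (hξ : ξ = (lamN - lamn) / lamn)
    (c : ι → ℝ) (hnorm : ‖∑ j ∈ C, c j • u j‖ = 1)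
    (lambar : ℝ) (hlambar : lambar = Real.sqrt (∑ j ∈ C, c j ^ 2 * lam j ^ 2)) :
    ‖(∑ j ∈ C, c j • u j) - lambar⁻¹ • ∑ j ∈ C, (c j * lam j) • u j‖ ^ 2
        = ∑ j ∈ C, c j ^ 2 * (1 - lam j / lambar) ^ 2 ∧
      ∑ j ∈ C, c j ^ 2 * (1 - lam j / lambar) ^ 2 ≤ ξ ^ 2 ∧
      ‖(∑ j ∈ C, c j • u j) - lambar⁻¹ • ∑ j ∈ C, (c j * lam j) • u j‖ ≤ ξ := by
  have hmin : ∀ j ∈ C, lamn ≤ lam j := fun j hj => hlamn ▸ Finset.inf'_le lam hj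
  have hmax : ∀ j ∈ C, lam j ≤ lamN := fun j hj => hlamN ▸ Finset.le_sup' lam hj
  have hn_pos : 0 < lamn := by
    rw [hlamn, Finset.lt_inf'_iff]
    exact hlam_pos
  have hnN : lamn ≤ lamN := by
    obtain ⟨j, hj⟩ := hC
    exact (hmin j hj).trans (hmax j hj)
  have hc : ∑ j ∈ C, c j ^ 2 = 1 := by
    rw [← norm_sq_sum_smul_of_orthonormal hu, hnorm, one_pow]
  have hbar_ge : lamn ≤ lambar := by
    rw [hlambar]
    apply Real.le_sqrt_of_sq_le
    calc lamn ^ 2 = ∑ j ∈ C, c j ^ 2 * lamn ^ 2 := by rw [← Finset.sum_mul, hc, one_mul]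
      _ ≤ _ := Finset.sum_le_sum fun j hj => by
        have := hmin j hj
        gcongr
  have hbar_le : lambar ≤ lamN := by
    rw [hlambar]
    apply Real.sqrt_le_iff.mpr ⟨hn_pos.le.trans hnN, ?_⟩
    calc _ ≤ ∑ j ∈ C, c j ^ 2 * lamN ^ 2 := Finset.sum_le_sum fun j hj => by
          have := hmax j hj
          have := (hlam_pos j hj).le
          gcongr
      _ = lamN ^ 2 := by rw [← Finset.sum_mul, hc, one_mul]
  have hbar_pos : 0 < lambar := hn_pos.trans_le hbar_ge
  have hξ_nonneg : 0 ≤ ξ := hξ ▸ div_nonneg (sub_nonneg.mpr hnN) hn_pos.le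
  have hcoeff : ∀ j ∈ C, |1 - lam j / lambar| ≤ ξ := fun j hj => by
    rw [one_sub_div hbar_pos.ne', abs_div, abs_of_pos hbar_pos, hξ]
    have habs : |lambar - lam j| ≤ lamN - lamn :=
      abs_le.mpr ⟨by linarith [hmax j hj], by linarith [hmin j hj]⟩
    exact div_le_div₀ (sub_nonneg.mpr hnN) habs hn_pos hbar_ge
  have heq : ‖(∑ j ∈ C, c j • u j) - lambar⁻¹ • ∑ j ∈ C, (c j * lam j) • u j‖ ^ 2
      = ∑ j ∈ C, c j ^ 2 * (1 - lam j / lambar) ^ 2 := by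
    have hdiff : (∑ j ∈ C, c j • u j) - lambar⁻¹ • ∑ j ∈ C, (c j * lam j) • u j
        = ∑ j ∈ C, (c j * (1 - lam j / lambar)) • u j := by
      rw [Finset.smul_sum, ← Finset.sum_sub_distrib]
      refine Finset.sum_congr rfl fun j _ => ?_
      rw [smul_smul, ← sub_smul]
      congr 1
      ring
    rw [hdiff, norm_sq_sum_smul_of_orthonormal hu]
    simp only [mul_pow]
  have hle : ∑ j ∈ C, c j ^ 2 * (1 - lam j / lambar) ^ 2 ≤ ξ ^ 2 :=
    calc _ ≤ ∑ j ∈ C, c j ^ 2 * ξ ^ 2 := Finset.sum_le_sum fun j hj =>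
          mul_le_mul_of_nonneg_left (sq_le_sq' (abs_le.mp (hcoeff j hj)).1
            (abs_le.mp (hcoeff j hj)).2) (sq_nonneg _)
      _ = ξ ^ 2 := by rw [← Finset.sum_mul, hc, one_mul]
  exact ⟨heq, hle, (sq_le_sq₀ (norm_nonneg _) hξ_nonneg).mp (heq.trans_le hle)⟩
end

section
/- The directed L² distance of the exact eigenfunction space E from the approximate space E_h satisfies the fully explicit bound δ_b(E, E_h) := sup_{u ∈ E^B} inf_{v ∈ E_h} ‖u − v‖ ≤ (1 + τ |C|^{1/2}) λ_N C_h², where |C| is the cardinality of C. -/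
open scoped RealInnerProductSpace

/-- Pythagoras for a finite combination of an orthonormal family. -/
theorem Orthonormal.norm_sq_sum_smul {H κ : Type*} [NormedAddCommGroup H]
    [InnerProductSpace ℝ H] {v : κ → H} (hv : Orthonormal ℝ v) (c : κ → ℝ) (s : Finset κ) :
    ‖∑ i ∈ s, c i • v i‖ ^ 2 = ∑ i ∈ s, c i ^ 2 := by
  rw [← real_inner_self_eq_norm_sq, hv.inner_sum]
  simp [sq]

/-- If `x` lies in the span of an orthonormal family `v` and, outside `s`, its coefficients are
bounded by `t` times those of `e`, then `x` is within `t * ‖e‖` of the span of `v` over `s`. -/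
theorem Orthonormal.exists_mem_span_image_norm_sub_le {H κ : Type*} [NormedAddCommGroup H]
    [InnerProductSpace ℝ H] [Fintype κ] [DecidableEq κ] {v : κ → H} (hv : Orthonormal ℝ v)
    (s : Finset κ) {x e : H} (hx : x ∈ Submodule.span ℝ (Set.range v)) {t : ℝ} (ht : 0 ≤ t)
    (hxe : ∀ i ∈ sᶜ, |⟪v i, x⟫| ≤ t * |⟪v i, e⟫|) :
    ∃ q ∈ Submodule.span ℝ (v '' (s : Set κ)), ‖x - q‖ ≤ t * ‖e‖ := by
  obtain ⟨c, rfl⟩ := (Submodule.mem_span_range_iff_exists_fun ℝ).1 hx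
  refine ⟨∑ i ∈ s, c i • v i, Submodule.sum_mem _ fun i hi => Submodule.smul_mem _ _
    (Submodule.subset_span ⟨i, hi, rfl⟩), ?_⟩
  rw [← Finset.sum_add_sum_compl s, add_sub_cancel_left]
  refine le_of_sq_le_sq ?_ (by positivity)
  rw [hv.norm_sq_sum_smul, mul_pow]
  calc ∑ i ∈ sᶜ, c i ^ 2 ≤ ∑ i ∈ sᶜ, t ^ 2 * ‖⟪v i, e⟫‖ ^ 2 := by
        refine Finset.sum_le_sum fun i hi => ?_
        have h := hxe i hi
        rw [hv.inner_right_fintype] at h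
        rw [← mul_pow, ← sq_abs, Real.norm_eq_abs]
        gcongr
    _ = t ^ 2 * ∑ i ∈ sᶜ, ‖⟪v i, e⟫‖ ^ 2 := by rw [Finset.mul_sum]
    _ ≤ t ^ 2 * ‖e‖ ^ 2 := by
        gcongr
        exact hv.sum_inner_products_le e

/-- δ_b(E, E_h) := sup_{u ∈ E^B} inf_{v ∈ E_h} ‖u − v‖
≤ (1 + τ |C|^{1/2}) λ_N C_h². -/
theorem stmt15
    {H : Type*} [NormedAddCommGroup H] [InnerProductSpace ℝ H]
    {ι : Type*} [Fintype ι] [DecidableEq ι]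
    (V : Submodule ℝ H)
    (a : H →ₗ[ℝ] H →ₗ[ℝ] ℝ)
    (hsym : ∀ x ∈ V, ∀ y ∈ V, a x y = a y x)
    (C : Finset ι) (hC : C.Nonempty) (hCc : Cᶜ.Nonempty)
    (uh : ι → H) (huh : Orthonormal ℝ uh)
    (hVh : Submodule.span ℝ (Set.range uh) ≤ V)
    (lamh : ι → ℝ) (hlamh_pos : ∀ i, 0 < lamh i)
    (heigh : ∀ i : ι, ∀ vh ∈ Submodule.span ℝ (Set.range uh),
      a (uh i) vh = lamh i * ⟪uh i, vh⟫)
    (u : ι → H) (hu : Orthonormal ℝ (fun (j : C) => u (j : ι)))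
    (huV : ∀ j ∈ C, u j ∈ V)
    (lam : ι → ℝ) (hlam_pos : ∀ j ∈ C, 0 < lam j)
    (heig : ∀ j ∈ C, ∀ v ∈ V, a (u j) v = lam j * ⟪u j, v⟫)
    (hsep : ∀ i ∈ Cᶜ, ∀ j ∈ C, lamh i ≠ lam j)
    (Ph : H →ₗ[ℝ] H)
    (hPh_mem : ∀ w : H, Ph w ∈ Submodule.span ℝ (Set.range uh))
    (hGal : ∀ w ∈ V, ∀ vh ∈ Submodule.span ℝ (Set.range uh), a (w - Ph w) vh = 0)
    (Pic : H →ₗ[ℝ] H)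
    (hPic_mem : ∀ φ : H, Pic φ ∈ Submodule.span ℝ (uh '' (C : Set ι)))
    (hPic_orth : ∀ φ : H, ∀ w ∈ Submodule.span ℝ (uh '' (C : Set ι)), ⟪φ - Pic φ, w⟫ = 0)
    (τ τh : ℝ)
    (hτ : τ = C.sup' hC fun j => Cᶜ.sup' hCc fun i => lam j / |lamh i - lam j|)
    (hτh : τh = C.sup' hC fun j => Cᶜ.sup' hCc fun i => lamh i / |lamh i - lam j|)
    (lamn lamN ξ : ℝ)
    (hlamn : lamn = C.inf' hC lam) (hlamN : lamN = C.sup' hC lam)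
    (hξ : ξ = (lamN - lamn) / lamn)
    (Ch : ℝ) (hCh0 : 0 ≤ Ch)
    (hCh : ∀ w ∈ V, ∀ f : H, (∀ v ∈ V, a w v = ⟪f, v⟫) → ‖w - Ph w‖ ≤ Ch ^ 2 * ‖f‖)
    :
    sSup ((fun w => sInf ((fun v => ‖w - v‖) ''
          (Submodule.span ℝ (uh '' (C : Set ι)) : Set H))) ''
        {w : H | w ∈ Submodule.span ℝ (u '' (C : Set ι)) ∧ ‖w‖ = 1})
      ≤ (1 + τ * Real.sqrt C.card) * lamN * Ch ^ 2 := by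
  have hτ_le : ∀ j ∈ C, ∀ i ∈ Cᶜ, lam j / |lamh i - lam j| ≤ τ := by
    intro j hj i hi
    rw [hτ]
    exact (Finset.le_sup' (fun i => lam j / |lamh i - lam j|) hi).trans
      (Finset.le_sup' (fun j => Cᶜ.sup' hCc fun i => lam j / |lamh i - lam j|) hj)
  have hlam_le : ∀ j ∈ C, lam j ≤ lamN := fun j hj => hlamN ▸ Finset.le_sup' lam hj
  obtain ⟨j₀, hj₀⟩ := hC
  obtain ⟨i₀, hi₀⟩ := hCc
  have hτ0 : 0 ≤ τ :=
    (div_nonneg (hlam_pos j₀ hj₀).le (abs_nonneg _)).trans (hτ_le j₀ hj₀ i₀ hi₀)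
  have hlamN0 : 0 ≤ lamN := (hlam_pos j₀ hj₀).le.trans (hlam_le j₀ hj₀)
  have huh_mem : ∀ i, uh i ∈ Submodule.span ℝ (Set.range uh) := fun i =>
    Submodule.subset_span ⟨i, rfl⟩
  have key : ∀ j : C, ∃ q ∈ Submodule.span ℝ (uh '' (C : Set ι)),
      ‖Ph (u j) - q‖ ≤ τ * lamN * Ch ^ 2 := by
    rintro ⟨j, hj⟩
    have herr : ‖u j - Ph (u j)‖ ≤ lamN * Ch ^ 2 := by
      have h := hCh (u j) (huV j hj) (lam j • u j) fun v hv => by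
        rw [heig j hj v hv, real_inner_smul_left]
      have h1 : ‖u j‖ = 1 := hu.1 ⟨j, hj⟩
      rw [norm_smul, h1, mul_one, Real.norm_of_nonneg (hlam_pos j hj).le] at h
      nlinarith [hlam_le j hj, sq_nonneg Ch]
    obtain ⟨q, hq, hle⟩ := huh.exists_mem_span_image_norm_sub_le C (hPh_mem (u j))
      (e := u j - Ph (u j)) hτ0 (by
        intro i hi
        have h1 := heigh i _ (hPh_mem (u j))
        have h2 := hsym _ (hVh (huh_mem i)) _ (hVh (hPh_mem (u j)))
        have h3 := hGal _ (huV j hj) _ (huh_mem i)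
        have h4 := heig j hj _ (hVh (huh_mem i))
        rw [map_sub, LinearMap.sub_apply] at h3
        rw [real_inner_comm] at h4
        have h5 : (lamh i - lam j) * ⟪uh i, Ph (u j)⟫ = lam j * ⟪uh i, u j - Ph (u j)⟫ := by
          rw [inner_sub_right]
          linarith
        have hpos : 0 < |lamh i - lam j| := abs_pos.2 (sub_ne_zero.2 (hsep i hi j hj))
        have h6 := congrArg abs h5
        rw [abs_mul, abs_mul, abs_of_pos (hlam_pos j hj)] at h6
        calc |⟪uh i, Ph (u j)⟫|
            = lam j / |lamh i - lam j| * |⟪uh i, u j - Ph (u j)⟫| := by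
              field_simp
              linarith
          _ ≤ _ := by
              gcongr
              exact hτ_le j hj i hi)
    refine ⟨q, hq, hle.trans ?_⟩
    rw [mul_assoc]
    gcongr
  choose q hq hq_le using key
  refine Real.sSup_le ?_ (by positivity)
  rintro _ ⟨w, ⟨hw, hw1⟩, rfl⟩
  rw [show u '' (C : Set ι) = Set.range fun j : C => u j from Set.image_eq_range u C] at hw
  obtain ⟨b, rfl⟩ := (Submodule.mem_span_range_iff_exists_fun ℝ).1 hw
  have hb : ∑ j, b j ^ 2 = 1 := by
    rw [← hu.norm_sq_sum_smul b, hw1, one_pow]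
  have hb1 : ∑ j, |b j| ≤ Real.sqrt C.card := by
    refine Real.le_sqrt_of_sq_le ?_
    have h := sq_sum_le_card_mul_sum_sq (s := Finset.univ) (f := fun j : C => |b j|)
    simpa only [sq_abs, hb, mul_one, Finset.card_univ, Fintype.card_coe] using h
  have hsum : ‖∑ j : C, (lam j * b j) • u j‖ ≤ lamN := by
    refine le_of_sq_le_sq ?_ hlamN0
    rw [hu.norm_sq_sum_smul (fun j : C => lam j * b j), ← mul_one (lamN ^ 2), ← hb,
      Finset.mul_sum]
    refine Finset.sum_le_sum fun j _ => ?_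
    rw [mul_pow]
    have := (hlam_pos j j.2).le
    have := hlam_le j j.2
    gcongr
  set w := ∑ j : C, b j • u j
  have herr : ‖w - Ph w‖ ≤ Ch ^ 2 * lamN := by
    refine (hCh w (Submodule.sum_mem _ fun j _ => Submodule.smul_mem _ _ (huV j j.2))
      (∑ j : C, (lam j * b j) • u j) fun v hv => ?_).trans (by gcongr)
    simp only [w, map_sum, map_smul, LinearMap.sum_apply, LinearMap.smul_apply, sum_inner,
      real_inner_smul_left, smul_eq_mul]
    refine Finset.sum_congr rfl fun j _ => ?_
    rw [heig j j.2 v hv]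
    ring
  have hdiff : ‖Ph w - ∑ j, b j • q j‖ ≤ Real.sqrt C.card * (τ * lamN * Ch ^ 2) := by
    have h : Ph w - ∑ j, b j • q j = ∑ j : C, b j • (Ph (u j) - q j) := by
      simp [w, smul_sub]
    rw [h]
    calc ‖∑ j : C, b j • (Ph (u j) - q j)‖ ≤ ∑ j : C, |b j| * (τ * lamN * Ch ^ 2) := by
          refine norm_sum_le_of_le _ fun j _ => ?_
          rw [norm_smul, Real.norm_eq_abs]
          exact mul_le_mul_of_nonneg_left (hq_le j) (abs_nonneg _)
      _ ≤ _ := by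
          rw [← Finset.sum_mul]
          gcongr
  have hbdd : BddBelow ((fun v => ‖w - v‖) '' (Submodule.span ℝ (uh '' (C : Set ι)) : Set H)) :=
    ⟨0, by rintro _ ⟨v, _, rfl⟩; exact norm_nonneg _⟩
  refine (csInf_le hbdd ⟨∑ j, b j • q j, Submodule.sum_mem _ fun j _ =>
    Submodule.smul_mem _ _ (hq j), rfl⟩).trans ?_
  have htri := norm_sub_le_norm_sub_add_norm_sub w (Ph w) (∑ j, b j • q j)
  linarith
end

section
/- If τ_h ξ < 1 − |C|^{−1/2}, where |C| is the cardinality of C, then the directed L² distance of the exact eigenfunction space E from the approximate space E_h satisfies the sharper fully explicit bound δ_b(E, E_h) := sup_{u ∈ E^B} inf_{v ∈ E_h} ‖u − v‖ ≤ (1 + τ/(1 − τ_h ξ)) λ_N C_h². -/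
open scoped RealInnerProductSpace

open Finset in
/-- The squared norm of a linear combination of an orthonormal family indexed by a finset. -/
theorem norm_sq_sum_smul_of_orthonormal_finset
    {H : Type*} [NormedAddCommGroup H] [InnerProductSpace ℝ H] {ι : Type*}
    {s : Finset ι} {x : ι → H} (hx : Orthonormal ℝ (fun j : s => x (j : ι))) (b : ι → ℝ) :
    ‖∑ i ∈ s, b i • x i‖ ^ 2 = ∑ i ∈ s, b i ^ 2 := by
  have h := hx.inner_sum (fun j : s => b j) (fun j : s => b j) univ
  rw [← sum_coe_sort s (fun i => b i • x i), ← real_inner_self_eq_norm_sq, h,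
    ← sum_coe_sort s (fun i => b i ^ 2)]
  exact sum_congr rfl fun i _ => by simp [sq]

open Finset in
/-- A diagonal multiplier bounded by `M` has norm at most `M` on the span of an orthonormal
family. -/
theorem norm_sum_mul_smul_le_of_orthonormal_finset
    {H : Type*} [NormedAddCommGroup H] [InnerProductSpace ℝ H] {ι : Type*}
    {s : Finset ι} {x : ι → H} (hx : Orthonormal ℝ (fun j : s => x (j : ι))) (b c : ι → ℝ)
    {M : ℝ} (hM : 0 ≤ M) (hc : ∀ i ∈ s, |c i| ≤ M) :
    ‖∑ i ∈ s, (c i * b i) • x i‖ ≤ M * ‖∑ i ∈ s, b i • x i‖ := by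
  refine le_of_sq_le_sq ?_ (by positivity)
  rw [mul_pow, norm_sq_sum_smul_of_orthonormal_finset hx,
    norm_sq_sum_smul_of_orthonormal_finset hx, mul_sum]
  refine sum_le_sum fun i hi => ?_
  rw [mul_pow]
  exact mul_le_mul_of_nonneg_right (sq_le_sq' (abs_le.1 (hc i hi)).1 (abs_le.1 (hc i hi)).2)
    (sq_nonneg _)

open Finset in
/-- Bessel's inequality for the truncated Fourier sum. -/
theorem norm_sum_inner_smul_le_of_orthonormal
    {H : Type*} [NormedAddCommGroup H] [InnerProductSpace ℝ H] {ι : Type*}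
    {x : ι → H} (hx : Orthonormal ℝ x) (s : Finset ι) (v : H) :
    ‖∑ i ∈ s, ⟪x i, v⟫ • x i‖ ≤ ‖v‖ := by
  refine le_of_sq_le_sq ?_ (norm_nonneg _)
  rw [norm_sq_sum_smul_of_orthonormal_finset (hx.comp _ Subtype.val_injective)]
  simpa using hx.sum_inner_products_le v (s := s)

/-- A bounded ratio that reproduces itself up to a contraction factor `B * r < 1` is bounded by
the value of the associated geometric series. -/
theorem le_div_one_sub_mul_of_iterate {T : Type*} (F g : T → ℝ) (S : T → T) {A B r K : ℝ}
    (hB : 0 ≤ B) (hr : 0 ≤ r) (hBr : B * r < 1)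
    (hg : ∀ x, 0 ≤ g x) (hF : ∀ x, F x ≤ A * g x + B * F (S x)) (hS : ∀ x, g (S x) ≤ r * g x)
    (hA : 0 ≤ A) (hK0 : 0 ≤ K) (hK : ∀ x, F x ≤ K * g x) (x : T) :
    F x ≤ A / (1 - B * r) * g x := by
  have hpos : 0 < 1 - B * r := by linarith
  have key : ∀ n : ℕ, ∀ x, F x ≤ (A / (1 - B * r) + (B * r) ^ n * K) * g x := by
    intro n
    induction n with
    | zero =>
      intro x
      have : 0 ≤ A / (1 - B * r) * g x := mul_nonneg (by positivity) (hg x)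
      linarith [hK x]
    | succ n ih =>
      intro x
      have hL : 0 ≤ A / (1 - B * r) + (B * r) ^ n * K := by positivity
      calc F x ≤ A * g x + B * F (S x) := hF x
        _ ≤ A * g x + B * ((A / (1 - B * r) + (B * r) ^ n * K) * (r * g x)) := by
          gcongr
          exact (ih (S x)).trans (mul_le_mul_of_nonneg_left (hS x) hL)
        _ = _ := by field_simp; ring
  have hlim := (((tendsto_pow_atTop_nhds_zero_of_lt_one (by positivity) hBr).mul_const K).const_add
    (A / (1 - B * r))).mul_const (g x)
  rw [zero_mul, add_zero] at hlim
  exact ge_of_tendsto' hlim fun n => key n x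

/-- if τ_h ξ < 1 − |C|^{−1/2}, then
δ_b(E, E_h) := sup_{u ∈ E^B} inf_{v ∈ E_h} ‖u − v‖ ≤ (1 + τ/(1 − τ_h ξ)) λ_N C_h². -/
theorem stmt16
    {H : Type*} [NormedAddCommGroup H] [InnerProductSpace ℝ H]
    {ι : Type*} [Fintype ι] [DecidableEq ι]
    (V : Submodule ℝ H)
    (a : H →ₗ[ℝ] H →ₗ[ℝ] ℝ)
    (hsym : ∀ x ∈ V, ∀ y ∈ V, a x y = a y x)
    (C : Finset ι) (hC : C.Nonempty) (hCc : Cᶜ.Nonempty)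
    (uh : ι → H) (huh : Orthonormal ℝ uh)
    (hVh : Submodule.span ℝ (Set.range uh) ≤ V)
    (lamh : ι → ℝ) (hlamh_pos : ∀ i, 0 < lamh i)
    (heigh : ∀ i : ι, ∀ vh ∈ Submodule.span ℝ (Set.range uh),
      a (uh i) vh = lamh i * ⟪uh i, vh⟫)
    (u : ι → H) (hu : Orthonormal ℝ (fun (j : C) => u (j : ι)))
    (huV : ∀ j ∈ C, u j ∈ V)
    (lam : ι → ℝ) (hlam_pos : ∀ j ∈ C, 0 < lam j)
    (heig : ∀ j ∈ C, ∀ v ∈ V, a (u j) v = lam j * ⟪u j, v⟫)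
    (hsep : ∀ i ∈ Cᶜ, ∀ j ∈ C, lamh i ≠ lam j)
    (Ph : H →ₗ[ℝ] H)
    (hPh_mem : ∀ w : H, Ph w ∈ Submodule.span ℝ (Set.range uh))
    (hGal : ∀ w ∈ V, ∀ vh ∈ Submodule.span ℝ (Set.range uh), a (w - Ph w) vh = 0)
    (Pic : H →ₗ[ℝ] H)
    (hPic_mem : ∀ φ : H, Pic φ ∈ Submodule.span ℝ (uh '' (C : Set ι)))
    (hPic_orth : ∀ φ : H, ∀ w ∈ Submodule.span ℝ (uh '' (C : Set ι)), ⟪φ - Pic φ, w⟫ = 0)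
    (τ τh : ℝ)
    (hτ : τ = C.sup' hC fun j => Cᶜ.sup' hCc fun i => lam j / |lamh i - lam j|)
    (hτh : τh = C.sup' hC fun j => Cᶜ.sup' hCc fun i => lamh i / |lamh i - lam j|)
    (lamn lamN ξ : ℝ)
    (hlamn : lamn = C.inf' hC lam) (hlamN : lamN = C.sup' hC lam)
    (hξ : ξ = (lamN - lamn) / lamn)
    (Ch : ℝ) (hCh0 : 0 ≤ Ch)
    (hCh : ∀ w ∈ V, ∀ f : H, (∀ v ∈ V, a w v = ⟪f, v⟫) → ‖w - Ph w‖ ≤ Ch ^ 2 * ‖f‖)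
    (hcond : τh * ξ < 1 - (Real.sqrt C.card)⁻¹) :
    sSup ((fun w => sInf ((fun v => ‖w - v‖) ''
          (Submodule.span ℝ (uh '' (C : Set ι)) : Set H))) ''
        {w : H | w ∈ Submodule.span ℝ (u '' (C : Set ι)) ∧ ‖w‖ = 1})
      ≤ (1 + τ / (1 - τh * ξ)) * lamN * Ch ^ 2 := by
  obtain ⟨j₀, hj₀, hj₀n⟩ := C.exists_mem_eq_inf' hC lam
  rw [← hlamn] at hj₀n
  have hn_le : ∀ j ∈ C, lamn ≤ lam j := fun j hj => hlamn ▸ Finset.inf'_le lam hj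
  have hle_N : ∀ j ∈ C, lam j ≤ lamN := fun j hj => hlamN ▸ Finset.le_sup' lam hj
  have hn_pos : 0 < lamn := hj₀n ▸ hlam_pos j₀ hj₀
  have hN_pos : 0 < lamN := (hlam_pos j₀ hj₀).trans_le (hle_N j₀ hj₀)
  have hξ0 : 0 ≤ ξ := by
    rw [hξ]
    exact div_nonneg (by linarith [hle_N j₀ hj₀]) hn_pos.le
  have hτi : ∀ i ∈ Cᶜ, lamn / |lamh i - lamn| ≤ τ := by
    intro i hi
    rw [hτ, hj₀n]
    exact (Finset.le_sup' (fun i => lam j₀ / |lamh i - lam j₀|) hi).trans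
      (Finset.le_sup' (fun j => Cᶜ.sup' hCc fun i => lam j / |lamh i - lam j|) hj₀)
  have hτhi : ∀ i ∈ Cᶜ, lamh i / |lamh i - lamn| ≤ τh := by
    intro i hi
    rw [hτh, hj₀n]
    exact (Finset.le_sup' (fun i => lamh i / |lamh i - lam j₀|) hi).trans
      (Finset.le_sup' (fun j => Cᶜ.sup' hCc fun i => lamh i / |lamh i - lam j|) hj₀)
  obtain ⟨i₀, hi₀⟩ := hCc
  have hτ0 : 0 ≤ τ := le_trans (by positivity) (hτi i₀ hi₀)
  have hτh0 : 0 ≤ τh :=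
    le_trans (div_nonneg (hlamh_pos i₀).le (abs_nonneg _)) (hτhi i₀ hi₀)
  have hlt1 : τh * ξ < 1 := by
    have : 0 ≤ (Real.sqrt C.card)⁻¹ := by positivity
    linarith
  let U : (ι → ℝ) → H := fun α => ∑ j ∈ C, α j • u j
  have hUV : ∀ α, U α ∈ V := fun α =>
    V.sum_mem fun j hj => V.smul_mem _ (huV j hj)
  have hUa : ∀ α, ∀ v ∈ V, a (U α) v = ⟪U (fun j => lam j * α j), v⟫ := by
    intro α v hv
    simp only [U, map_sum, LinearMap.sum_apply, sum_inner, map_smul, LinearMap.smul_apply,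
      real_inner_smul_left, smul_eq_mul]
    refine Finset.sum_congr rfl fun j hj => ?_
    rw [heig j hj v hv]
    ring
  have hUP : ∀ α, ‖U α - Ph (U α)‖ ≤ lamN * Ch ^ 2 * ‖U α‖ := by
    intro α
    refine (hCh _ (hUV α) _ (hUa α)).trans ?_
    have := norm_sum_mul_smul_le_of_orthonormal_finset hu α lam hN_pos.le
      fun j hj => by rw [abs_of_pos (hlam_pos j hj)]; exact hle_N j hj
    calc Ch ^ 2 * ‖U (fun j => lam j * α j)‖ ≤ Ch ^ 2 * (lamN * ‖U α‖) := by gcongr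
      _ = _ := by ring
  have huh_mem : ∀ i, uh i ∈ Submodule.span ℝ (Set.range uh) := fun i =>
    Submodule.subset_span ⟨i, rfl⟩
  have hPinner : ∀ α i, lamh i * ⟪uh i, Ph (U α)⟫ = ⟪uh i, U (fun j => lam j * α j)⟫ := by
    intro α i
    have h := hGal (U α) (hUV α) (uh i) (huh_mem i)
    rw [map_sub, LinearMap.sub_apply, hUa α _ (hVh (huh_mem i)),
      hsym _ (hVh (hPh_mem _)) _ (hVh (huh_mem i)), heigh i _ (hPh_mem _), real_inner_comm] at h
    linarith
  let S : (ι → ℝ) → (ι → ℝ) := fun α j => (1 - lamn / lam j) * α j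
  have hS : ∀ α, ‖U (S α)‖ ≤ ξ * ‖U α‖ := by
    intro α
    refine norm_sum_mul_smul_le_of_orthonormal_finset hu α _ hξ0 fun j hj => ?_
    have hjp := hlam_pos j hj
    have h1 : lamn / lam j ≤ 1 := (div_le_one hjp).2 (hn_le j hj)
    rw [abs_of_nonneg (by linarith), hξ, one_sub_div hjp.ne']
    exact div_le_div₀ (by linarith [hle_N j hj, hn_le j hj]) (by linarith [hle_N j hj]) hn_pos
      (hn_le j hj)
  have hident : ∀ α i, (lamh i - lamn) * ⟪uh i, Ph (U α)⟫
      = lamn * ⟪uh i, U α - Ph (U α)⟫ + lamh i * ⟪uh i, Ph (U (S α))⟫ := by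
    intro α i
    have hUS : U (fun j => lam j * S α j) = U (fun j => lam j * α j) - lamn • U α := by
      simp only [U, S, Finset.smul_sum, ← Finset.sum_sub_distrib, smul_smul, ← sub_smul]
      refine Finset.sum_congr rfl fun j hj => ?_
      have := (hlam_pos j hj).ne'
      congr 1
      field_simp
    rw [hPinner, hUS, inner_sub_right, inner_sub_right, real_inner_smul_right, ← hPinner]
    ring
  let Q : H → H := fun v => ∑ i ∈ Cᶜ, ⟪uh i, v⟫ • uh i
  have huhc : Orthonormal ℝ (fun j : (Cᶜ : Finset ι) => uh (j : ι)) :=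
    huh.comp _ Subtype.val_injective
  have hne : ∀ i ∈ Cᶜ, lamh i - lamn ≠ 0 := fun i hi =>
    sub_ne_zero.2 (hj₀n ▸ hsep i hi j₀ hj₀)
  have hstep : ∀ α, ‖Q (Ph (U α))‖ ≤
      τ * (lamN * Ch ^ 2) * ‖U α‖ + τh * ‖Q (Ph (U (S α)))‖ := by
    intro α
    have hsplit : Q (Ph (U α)) =
        ∑ i ∈ Cᶜ, (lamn / (lamh i - lamn) * ⟪uh i, U α - Ph (U α)⟫) • uh i +
        ∑ i ∈ Cᶜ, (lamh i / (lamh i - lamn) * ⟪uh i, Ph (U (S α))⟫) • uh i := by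
      rw [← Finset.sum_add_distrib]
      refine Finset.sum_congr rfl fun i hi => ?_
      rw [← add_smul]
      congr 1
      have := hne i hi
      field_simp
      linarith [hident α i]
    have h1 := norm_sum_mul_smul_le_of_orthonormal_finset huhc
      (fun i => ⟪uh i, U α - Ph (U α)⟫) (fun i => lamn / (lamh i - lamn)) hτ0
      fun i hi => by rw [abs_div, abs_of_pos hn_pos]; exact hτi i hi
    have h2 := norm_sum_mul_smul_le_of_orthonormal_finset huhc
      (fun i => ⟪uh i, Ph (U (S α))⟫) (fun i => lamh i / (lamh i - lamn)) hτh0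
      fun i hi => by rw [abs_div, abs_of_pos (hlamh_pos i)]; exact hτhi i hi
    have h3 := (norm_sum_inner_smul_le_of_orthonormal huh Cᶜ (U α - Ph (U α))).trans (hUP α)
    rw [hsplit]
    refine (norm_add_le _ _).trans (add_le_add (h1.trans ?_) h2)
    rw [mul_assoc]
    exact mul_le_mul_of_nonneg_left h3 hτ0
  have hbdd : ∀ α, ‖Q (Ph (U α))‖ ≤ (1 + lamN * Ch ^ 2) * ‖U α‖ := by
    intro α
    have h1 := norm_sum_inner_smul_le_of_orthonormal huh Cᶜ (Ph (U α))
    have h2 := norm_le_norm_add_norm_sub (U α) (Ph (U α))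
    linarith [hUP α]
  have hQ : ∀ α, ‖Q (Ph (U α))‖ ≤ τ * (lamN * Ch ^ 2) / (1 - τh * ξ) * ‖U α‖ :=
    le_div_one_sub_mul_of_iterate (fun α => ‖Q (Ph (U α))‖) (fun α => ‖U α‖) S hτh0 hξ0 hlt1
      (fun α => norm_nonneg _) hstep hS (by positivity) (by positivity) hbdd
  have hpos : 0 < 1 - τh * ξ := by linarith
  refine Real.sSup_le ?_ (by positivity)
  rintro _ ⟨w, ⟨hw, hw1⟩, rfl⟩
  obtain ⟨α, rfl⟩ : ∃ α, U α = w := by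
    obtain ⟨c, rfl⟩ := (Submodule.mem_span_image_finset_iff_exists_fun ℝ).1 hw
    refine ⟨fun j => if h : j ∈ C then c ⟨j, h⟩ else 0, ?_⟩
    simp only [U]
    rw [← Finset.sum_coe_sort C]
    exact Finset.sum_congr rfl fun j _ => by simp
  have hmem : Ph (U α) - Q (Ph (U α)) ∈ Submodule.span ℝ (uh '' (C : Set ι)) := by
    obtain ⟨c, hc⟩ := (Submodule.mem_span_range_iff_exists_fun ℝ).1 (hPh_mem (U α))
    have hcoef : ∀ i, ⟪uh i, Ph (U α)⟫ = c i := fun i => by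
      rw [← hc]
      exact huh.inner_right_fintype c i
    have : Ph (U α) - Q (Ph (U α)) = ∑ i ∈ C, c i • uh i := by
      rw [sub_eq_iff_eq_add]
      simp only [Q, hcoef]
      rw [Finset.sum_add_sum_compl, hc]
    rw [this]
    exact Submodule.sum_mem _ fun i hi =>
      Submodule.smul_mem _ _ (Submodule.subset_span ⟨i, hi, rfl⟩)
  have hinf : sInf ((fun v => ‖U α - v‖) '' (Submodule.span ℝ (uh '' (C : Set ι)) : Set H)) ≤
      ‖U α - (Ph (U α) - Q (Ph (U α)))‖ :=
    csInf_le ⟨0, by rintro _ ⟨v, _, rfl⟩; exact norm_nonneg _⟩ ⟨_, hmem, rfl⟩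
  refine hinf.trans ?_
  have h1 := hUP α
  have h2 := hQ α
  rw [hw1, mul_one] at h1 h2
  calc ‖U α - (Ph (U α) - Q (Ph (U α)))‖ = ‖(U α - Ph (U α)) + Q (Ph (U α))‖ := by
        congr 1; abel
    _ ≤ ‖U α - Ph (U α)‖ + ‖Q (Ph (U α))‖ := norm_add_le _ _
    _ ≤ lamN * Ch ^ 2 + τ * (lamN * Ch ^ 2) / (1 - τh * ξ) := add_le_add h1 h2
    _ = _ := by ring
end
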